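/- For every k ∈ {2, …, M+2}, the maximum over all subsets T ⊆ N∖M of F_k(T) is attained at T = D_k, where D_k is the unique largest subset of N∖M that is self-decodable at node π(k); that is, F_k(D_k) = max over T ⊆ N∖M of F_k(T). -/

import Mathlib

open scoped BigOperators

set_option synthInstance.maxHeartbeats 1000000
set_option synthInstance.maxSize 1024
set_option maxHeartbeats 1000000

/-- Shannon entropy (natural log) of a random variable `X` on a finite sample
space `Ω` with probability mass function `μ`. -/
noncomputable def entropy {Ω α : Type*} [Fintype Ω] [Fintype α] [DecidableEq α]
    (μ : Ω → ℝ) (X : Ω → α) : ℝ :=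
  ∑ a : α, Real.negMulLog (∑ ω ∈ Finset.univ.filter (fun ω => X ω = a), μ ω)

/-- Conditional mutual information `I(X;Y|Z)` for random variables on a finite
sample space with pmf `μ`. -/
noncomputable def condMI {Ω α β γ : Type*} [Fintype Ω]
    [Fintype α] [DecidableEq α] [Fintype β] [DecidableEq β] [Fintype γ] [DecidableEq γ]
    (μ : Ω → ℝ) (X : Ω → α) (Y : Ω → β) (Z : Ω → γ) : ℝ :=
  entropy μ (fun ω => (X ω, Z ω)) + entropy μ (fun ω => (Y ω, Z ω))
    - entropy μ (fun ω => (X ω, Y ω, Z ω)) - entropy μ Z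

/-- Sample space for the unified D-F/C-F multiple-relay framework: a value of
`(q, x₀, (xᵢ)ᵢ, (yᵢ)ᵢ, y_{n+1}, (ŷᵢ)ᵢ)`. -/
abbrev DFOmega {n : ℕ} (QA X0A : Type) (XA YA : Fin n → Type) (YdA : Type)
    (YhA : Fin n → Type) : Type :=
  QA × X0A × (∀ i, XA i) × (∀ i, YA i) × YdA × (∀ i, YhA i)

section DF

variable {n Mc : ℕ} {QA X0A YdA : Type} {XA YA YhA : Fin n → Type}

/-- The time-sharing variable `Q`. -/
def rvQ : DFOmega QA X0A XA YA YdA YhA → QA := fun ω => ω.1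

/-- The source input `X₀`. -/
def rvX0 : DFOmega QA X0A XA YA YdA YhA → X0A := fun ω => ω.2.1

/-- The tuple of relay inputs `X_S = (Xᵢ)_{i∈S}`. -/
def rvXS (S : Finset (Fin n)) : DFOmega QA X0A XA YA YdA YhA → (∀ i : S, XA i) :=
  fun ω i => ω.2.2.1 i

/-- The tuple of relay outputs `Y_S = (Yᵢ)_{i∈S}`. -/
def rvYS (S : Finset (Fin n)) : DFOmega QA X0A XA YA YdA YhA → (∀ i : S, YA i) :=
  fun ω i => ω.2.2.2.1 i

/-- The destination output `Y_{n+1}`. -/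
def rvYd : DFOmega QA X0A XA YA YdA YhA → YdA := fun ω => ω.2.2.2.2.1

/-- The tuple of compressions `Ŷ_S = (Ŷᵢ)_{i∈S}`. -/
def rvYhS (S : Finset (Fin n)) : DFOmega QA X0A XA YA YdA YhA → (∀ i : S, YhA i) :=
  fun ω i => ω.2.2.2.2.2 i

/-- The joint pmf
`p(q)·p(x₀|q)·p(x_M|x₀,q)·∏_{i∈N∖M} p(xᵢ|q) · p(y₁,…,y_{n+1}|x₀,…,x_n) ·
∏ p(ŷᵢ|yᵢ,xᵢ,q)`. -/
noncomputable def muDF (ℳ : Finset (Fin n)) (pQ : QA → ℝ) (p0 : QA → X0A → ℝ)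
    (pM : QA → X0A → (∀ i : ℳ, XA i) → ℝ) (pC : ∀ i : Fin n, QA → XA i → ℝ)
    (W : X0A → (∀ i, XA i) → ((∀ i, YA i) × YdA) → ℝ)
    (κ : ∀ i : Fin n, QA → YA i → XA i → YhA i → ℝ) :
    DFOmega QA X0A XA YA YdA YhA → ℝ :=
  fun ω => pQ ω.1 * p0 ω.1 ω.2.1 * pM ω.1 ω.2.1 (fun i => ω.2.2.1 i)
    * (∏ i ∈ ℳᶜ, pC i ω.1 (ω.2.2.1 i))
    * W ω.2.1 ω.2.2.1 (ω.2.2.2.1, ω.2.2.2.2.1)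
    * ∏ i, κ i ω.1 (ω.2.2.2.1 i) (ω.2.2.1 i) (ω.2.2.2.2.2 i)

/-- The set of relays upstream of node `π(k)` in the D-F route, i.e. the relays
`π(2:k-1)` of the paper: with `σ` enumerating the D-F relays in route order and
`k : Fin (Mc+1)` standing for the paper's index `k+2 ∈ {2,…,M+2}`, this is
`{σ j : j < k}`. -/
def upSet (σ : Fin Mc → Fin n) (k : Fin (Mc + 1)) : Finset (Fin n) :=
  (Finset.univ.filter (fun j : Fin Mc => (j : ℕ) < (k : ℕ))).image σ

/-- The set of relays `π(k:M+1)` of the paper, namely the D-F relays downstream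
of (and including) node `π(k)`: `{σ j : k ≤ j}`. -/
def downSet (σ : Fin Mc → Fin n) (k : Fin (Mc + 1)) : Finset (Fin n) :=
  (Finset.univ.filter (fun j : Fin Mc => (k : ℕ) ≤ (j : ℕ))).image σ

/-- The alphabet of the channel output `Y_{π(k)}` observed at node `π(k)`: a relay
output for `k < Mc`, and the destination output for `k = Mc` (paper `k = M+2`). -/
def YkType (σ : Fin Mc → Fin n) (YA : Fin n → Type) (YdA : Type)
    (k : Fin (Mc + 1)) : Type :=
  if h : (k : ℕ) < Mc then YA (σ ⟨(k : ℕ), h⟩) else YdA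

instance YkType.instFintype (σ : Fin Mc → Fin n) [∀ i, Fintype (YA i)] [Fintype YdA]
    (k : Fin (Mc + 1)) : Fintype (YkType σ YA YdA k) := by
  unfold YkType; split <;> infer_instance

instance YkType.instDecidableEq (σ : Fin Mc → Fin n) [∀ i, DecidableEq (YA i)]
    [DecidableEq YdA] (k : Fin (Mc + 1)) : DecidableEq (YkType σ YA YdA k) := by
  unfold YkType; split <;> infer_instance

/-- The channel output `Y_{π(k)}` observed at node `π(k)`. -/
def rvYk (σ : Fin Mc → Fin n) (k : Fin (Mc + 1))
    (ω : DFOmega QA X0A XA YA YdA YhA) : YkType σ YA YdA k :=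
  if h : (k : ℕ) < Mc then
    cast (by simp [YkType, h]) (ω.2.2.2.1 (σ ⟨(k : ℕ), h⟩))
  else
    cast (by simp [YkType, h]) ω.2.2.2.2.1

variable [Fintype QA] [DecidableEq QA] [Fintype X0A] [DecidableEq X0A]
  [Fintype YdA] [DecidableEq YdA]
  [∀ i, Fintype (XA i)] [∀ i, DecidableEq (XA i)]
  [∀ i, Fintype (YA i)] [∀ i, DecidableEq (YA i)]
  [∀ i, Fintype (YhA i)] [∀ i, DecidableEq (YhA i)]

/-- `F_k(T) = min_{S ⊆ T} [ I(X_{π(1:k-1)}, X_S; Ŷ_{T∖S}, Y_{π(k)} | X_{T∖S}, X_{π(k:M+1)}, Q)`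
`− I(Y_S; Ŷ_S | X_{π(1:M+1)}, X_T, Y_{π(k)}, Ŷ_{T∖S}, Q) ]`, where `π(1:k-1)`
consists of the source `0` together with `upSet σ k`, `π(k:M+1) = downSet σ k`,
and `π(1:M+1)` consists of the source together with all D-F relays `ℳ`. -/
noncomputable def Fk (ℳ : Finset (Fin n)) (σ : Fin Mc → Fin n)
    (μ : DFOmega QA X0A XA YA YdA YhA → ℝ) (k : Fin (Mc + 1))
    (T : Finset (Fin n)) : ℝ :=
  T.powerset.inf' (Finset.powerset_nonempty T) fun S =>
    condMI μ (fun ω => ((rvX0 ω, rvXS (upSet σ k) ω), rvXS S ω))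
      (fun ω => (rvYhS (T \ S) ω, rvYk σ k ω))
      (fun ω => (rvXS (T \ S) ω, rvXS (downSet σ k) ω, rvQ ω))
    - condMI μ (rvYS S) (rvYhS S)
      (fun ω => ((rvX0 ω, rvXS ℳ ω), rvXS T ω, rvYk σ k ω, rvYhS (T \ S) ω, rvQ ω))

/-- `D ⊆ N∖M` is self-decodable at node `π(k)` if for every nonempty `S ⊆ D`,
`I(X_S; Ŷ_{D∖S}, Y_{π(k)} | X_{π(1:M+1)}, X_{D∖S}, Q)`
`− I(Y_S; Ŷ_S | X_{π(1:M+1)}, X_D, Y_{π(k)}, Ŷ_{D∖S}, Q) > 0`. -/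
def SelfDecodable (ℳ : Finset (Fin n)) (σ : Fin Mc → Fin n)
    (μ : DFOmega QA X0A XA YA YdA YhA → ℝ) (k : Fin (Mc + 1))
    (D : Finset (Fin n)) : Prop :=
  ∀ S ⊆ D, S.Nonempty →
    0 < condMI μ (rvXS S) (fun ω => (rvYhS (D \ S) ω, rvYk σ k ω))
          (fun ω => ((rvX0 ω, rvXS ℳ ω), rvXS (D \ S) ω, rvQ ω))
      - condMI μ (rvYS S) (rvYhS S)
          (fun ω => ((rvX0 ω, rvXS ℳ ω), rvXS D ω, rvYk σ k ω, rvYhS (D \ S) ω, rvQ ω))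

end DF

/-- The probability that `X` takes the value `a`. -/
noncomputable def massAt {Ω α : Type*} [Fintype Ω] [DecidableEq α]
    (μ : Ω → ℝ) (X : Ω → α) (a : α) : ℝ :=
  ∑ ω ∈ Finset.univ.filter (fun ω => X ω = a), μ ω

section Entropy

variable {Ω α β γ : Type*} [Fintype Ω] [Fintype α] [DecidableEq α] [Fintype β] [DecidableEq β]
  [Fintype γ] [DecidableEq γ]

lemma sum_massAt_mul (μ : Ω → ℝ) (X : Ω → α) (f : α → ℝ) :
    ∑ a, massAt μ X a * f a = ∑ ω, μ ω * f (X ω) := by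
  rw [← Finset.sum_fiberwise (s := Finset.univ) (g := X)]
  refine Finset.sum_congr rfl fun a _ => ?_
  rw [massAt, Finset.sum_mul]
  refine Finset.sum_congr rfl fun ω hω => ?_
  rw [(Finset.mem_filter.1 hω).2]

lemma sum_massAt (μ : Ω → ℝ) (X : Ω → α) : ∑ a, massAt μ X a = ∑ ω, μ ω := by
  simpa using sum_massAt_mul μ X fun _ => 1

omit [Fintype γ] in
lemma sum_massAt_prod (μ : Ω → ℝ) (X : Ω → α) (Z : Ω → γ) (c : γ) :
    ∑ a, massAt μ (fun ω => (X ω, Z ω)) (a, c) = massAt μ Z c := by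
  simp only [massAt, Prod.mk.injEq]
  rw [← Finset.sum_fiberwise (s := Finset.univ.filter fun ω => Z ω = c) (g := X)]
  refine Finset.sum_congr rfl fun a _ => ?_
  rw [Finset.filter_filter]
  simp only [and_comm]

omit [Fintype α] in
lemma massAt_nonneg {μ : Ω → ℝ} (hμ : ∀ ω, 0 ≤ μ ω) (X : Ω → α) (a : α) : 0 ≤ massAt μ X a :=
  Finset.sum_nonneg fun ω _ => hμ ω

omit [Fintype α] in
lemma le_massAt {μ : Ω → ℝ} (hμ : ∀ ω, 0 ≤ μ ω) (X : Ω → α) (ω : Ω) :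
    μ ω ≤ massAt μ X (X ω) :=
  Finset.single_le_sum (f := μ) (fun ω _ => hμ ω) (by simp)

lemma entropy_eq_sum (μ : Ω → ℝ) (X : Ω → α) :
    entropy μ X = ∑ ω, μ ω * -Real.log (massAt μ X (X ω)) := by
  rw [← sum_massAt_mul μ X fun a => -Real.log (massAt μ X a)]
  simp [entropy, massAt, Real.negMulLog]

/-- Entropy depends only on the partition of the sample space induced by the variable. -/
lemma entropy_congr (μ : Ω → ℝ) {X : Ω → α} {Y : Ω → β}
    (h : ∀ ω ω', X ω = X ω' ↔ Y ω = Y ω') : entropy μ X = entropy μ Y := by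
  simp only [entropy_eq_sum, massAt, h]

/-- Chain rule for a variable `X` whose conditional law given `Z` is the kernel `p`. -/
lemma entropy_prod_of_massAt {μ : Ω → ℝ} (hμ : ∀ ω, 0 ≤ μ ω) (X : Ω → α) (Z : Ω → γ) (p : Ω → ℝ)
    (h : ∀ ω, massAt μ (fun ω => (X ω, Z ω)) (X ω, Z ω) = massAt μ Z (Z ω) * p ω) :
    entropy μ (fun ω => (X ω, Z ω)) = entropy μ Z + ∑ ω, μ ω * -Real.log (p ω) := by
  rw [entropy_eq_sum, entropy_eq_sum, ← Finset.sum_add_distrib]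
  refine Finset.sum_congr rfl fun ω _ => ?_
  rcases (hμ ω).eq_or_lt with h0 | h0
  · simp [← h0]
  · have h1 := h0.trans_le (le_massAt hμ (fun ω => (X ω, Z ω)) ω)
    simp only [h] at h1 ⊢
    have h2 := h0.trans_le (le_massAt hμ Z ω)
    have h3 : p ω ≠ 0 := by rintro h3; simp [h3] at h1
    rw [Real.log_mul h2.ne' h3]
    ring

lemma condMI_nonneg {μ : Ω → ℝ} (hμ : ∀ ω, 0 ≤ μ ω) (X : Ω → α) (Y : Ω → β) (Z : Ω → γ) :
    0 ≤ condMI μ X Y Z := by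
  set pxz := massAt μ fun ω => (X ω, Z ω)
  set pyz := massAt μ fun ω => (Y ω, Z ω)
  set pz := massAt μ Z
  set pxyz := massAt μ fun ω => (X ω, Y ω, Z ω)
  have hxz : ∀ a, 0 ≤ pxz a := massAt_nonneg hμ _
  have hyz : ∀ a, 0 ≤ pyz a := massAt_nonneg hμ _
  have hz : ∀ a, 0 ≤ pz a := massAt_nonneg hμ _
  have key : ∑ ω, μ ω * (pxz (X ω, Z ω) * pyz (Y ω, Z ω) /
      (pxyz (X ω, Y ω, Z ω) * pz (Z ω))) ≤ ∑ ω, μ ω := by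
    rw [← sum_massAt_mul μ (fun ω => (X ω, Y ω, Z ω)) fun t =>
      pxz (t.1, t.2.2) * pyz (t.2.1, t.2.2) / (pxyz t * pz t.2.2)]
    calc _ ≤ ∑ t : α × β × γ, pxz (t.1, t.2.2) * pyz (t.2.1, t.2.2) / pz t.2.2 := by
          refine Finset.sum_le_sum fun t _ => ?_
          have h0 : 0 ≤ pxz (t.1, t.2.2) * pyz (t.2.1, t.2.2) / pz t.2.2 :=
            div_nonneg (mul_nonneg (hxz _) (hyz _)) (hz _)
          change pxyz t * _ ≤ _
          by_cases ht : pxyz t = 0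
          · simpa [ht] using h0
          · apply le_of_eq
            rw [mul_div_assoc', mul_div_mul_left _ _ ht]
      _ = ∑ c, pz c * pz c / pz c := by
          rw [Fintype.sum_prod_type]
          simp only [Fintype.sum_prod_type]
          simp only [Finset.sum_comm (s := (Finset.univ : Finset β)) (t := (Finset.univ : Finset γ))]
          rw [Finset.sum_comm]
          refine Finset.sum_congr rfl fun c _ => ?_
          simp only [← Finset.sum_div, ← Finset.mul_sum, ← Finset.sum_mul]
          rw [sum_massAt_prod, sum_massAt_prod]
      _ = ∑ ω, μ ω := by
          simp only [mul_self_div_self]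
          exact sum_massAt μ Z
  have hsum : condMI μ X Y Z = ∑ ω, μ ω * -Real.log (pxz (X ω, Z ω) * pyz (Y ω, Z ω) /
      (pxyz (X ω, Y ω, Z ω) * pz (Z ω))) := by
    rw [condMI]
    simp only [entropy_eq_sum]
    rw [← Finset.sum_add_distrib, ← Finset.sum_sub_distrib, ← Finset.sum_sub_distrib]
    refine Finset.sum_congr rfl fun ω _ => ?_
    rcases (hμ ω).eq_or_lt with h0 | h0
    · simp [← h0]
    · have h1 : 0 < pxz (X ω, Z ω) := h0.trans_le (le_massAt hμ (fun ω => (X ω, Z ω)) ω)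
      have h2 : 0 < pyz (Y ω, Z ω) := h0.trans_le (le_massAt hμ (fun ω => (Y ω, Z ω)) ω)
      have h3 : 0 < pz (Z ω) := h0.trans_le (le_massAt hμ Z ω)
      have h4 : 0 < pxyz (X ω, Y ω, Z ω) :=
        h0.trans_le (le_massAt hμ (fun ω => (X ω, Y ω, Z ω)) ω)
      rw [Real.log_div (by positivity) (by positivity), Real.log_mul h1.ne' h2.ne',
        Real.log_mul h4.ne' h3.ne']
      ring
  rw [hsum]
  calc (0 : ℝ) ≤ ∑ ω, (μ ω - μ ω * (pxz (X ω, Z ω) * pyz (Y ω, Z ω) /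
        (pxyz (X ω, Y ω, Z ω) * pz (Z ω)))) := by
        rw [Finset.sum_sub_distrib]; linarith
    _ ≤ _ := by
        refine Finset.sum_le_sum fun ω _ => ?_
        rcases (hμ ω).eq_or_lt with h0 | h0
        · simp [← h0]
        · have h1 : 0 < pxz (X ω, Z ω) := h0.trans_le (le_massAt hμ (fun ω => (X ω, Z ω)) ω)
          have h2 : 0 < pyz (Y ω, Z ω) := h0.trans_le (le_massAt hμ (fun ω => (Y ω, Z ω)) ω)
          have h3 : 0 < pz (Z ω) := h0.trans_le (le_massAt hμ Z ω)
          have h4 : 0 < pxyz (X ω, Y ω, Z ω) :=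
            h0.trans_le (le_massAt hμ (fun ω => (X ω, Y ω, Z ω)) ω)
          have := Real.log_le_sub_one_of_pos
            (x := pxz (X ω, Z ω) * pyz (Y ω, Z ω) / (pxyz (X ω, Y ω, Z ω) * pz (Z ω)))
            (by positivity)
          nlinarith

end Entropy

/-- Integrating out one coordinate of a product against its conditional law. -/
lemma sum_pi_mul_ite {ι : Type*} [Fintype ι] [DecidableEq ι] {A : ι → Type*} [∀ i, Fintype (A i)]
    [∀ i, DecidableEq (A i)] (i : ι) (G : (∀ j, A j) → ℝ)
    (hG : ∀ x y, (∀ j, j ≠ i → x j = y j) → G x = G y)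
    (p : A i → ℝ) (hp : ∑ a, p a = 1) (a : A i) :
    ∑ x, (if x i = a then G x * p (x i) else 0) = (∑ x, G x * p (x i)) * p a := by
  rw [← (Equiv.piSplitAt i A).symm.sum_comp, ← (Equiv.piSplitAt i A).symm.sum_comp,
    Fintype.sum_prod_type_right, Fintype.sum_prod_type_right, Finset.sum_mul]
  refine Finset.sum_congr rfl fun f _ => ?_
  have hGa : ∀ b, G ((Equiv.piSplitAt i A).symm (b, f)) = G ((Equiv.piSplitAt i A).symm (a, f)) :=
    fun b => hG _ _ fun j hj => by simp [hj]
  simp [hGa, ← Finset.mul_sum, hp]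

section Chain

variable {n Mc : ℕ} {QA X0A YdA : Type} {XA YA YhA : Fin n → Type}
  [Fintype QA] [Fintype X0A] [Fintype YdA]
  [∀ i, Fintype (XA i)] [∀ i, DecidableEq (XA i)] [∀ i, Fintype (YA i)]
  [∀ i, Fintype (YhA i)] [∀ i, DecidableEq (YhA i)]
  {ℳ : Finset (Fin n)} {pQ : QA → ℝ} {p0 : QA → X0A → ℝ}
  {pM : QA → X0A → (∀ i : ℳ, XA i) → ℝ} {pC : ∀ i : Fin n, QA → XA i → ℝ}
  {W : X0A → (∀ i, XA i) → ((∀ i, YA i) × YdA) → ℝ}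
  {κ : ∀ i : Fin n, QA → YA i → XA i → YhA i → ℝ}
  {γ : Type*} [Fintype γ] [DecidableEq γ]

omit [∀ i, DecidableEq (XA i)] [Fintype γ] in
lemma massAt_compression (hκs : ∀ i q y x, ∑ yh, κ i q y x yh = 1) (i : Fin n)
    (Z : DFOmega QA X0A XA YA YdA YhA → γ)
    (hdep : ∀ q x0 x y yd yh yh', (∀ j, j ≠ i → yh j = yh' j) →
      Z (q, x0, x, y, yd, yh) = Z (q, x0, x, y, yd, yh'))
    (hdet : ∀ ω ω', Z ω = Z ω' →
      ω.1 = ω'.1 ∧ ω.2.2.1 i = ω'.2.2.1 i ∧ ω.2.2.2.1 i = ω'.2.2.2.1 i)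
    (ω : DFOmega QA X0A XA YA YdA YhA) :
    massAt (muDF ℳ pQ p0 pM pC W κ) (fun ω => (ω.2.2.2.2.2 i, Z ω)) (ω.2.2.2.2.2 i, Z ω) =
      massAt (muDF ℳ pQ p0 pM pC W κ) Z (Z ω) *
        κ i ω.1 (ω.2.2.2.1 i) (ω.2.2.1 i) (ω.2.2.2.2.2 i) := by
  simp only [massAt, Finset.sum_filter, Fintype.sum_prod_type]
  simp only [Finset.sum_mul (s := (Finset.univ : Finset QA)),
    Finset.sum_mul (s := (Finset.univ : Finset X0A)),
    Finset.sum_mul (s := (Finset.univ : Finset (∀ i, XA i))),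
    Finset.sum_mul (s := (Finset.univ : Finset (∀ i, YA i))),
    Finset.sum_mul (s := (Finset.univ : Finset YdA))]
  refine Finset.sum_congr rfl fun q _ => Finset.sum_congr rfl fun x0 _ =>
    Finset.sum_congr rfl fun x _ => Finset.sum_congr rfl fun y _ =>
    Finset.sum_congr rfl fun yd _ => ?_
  have hμ : ∀ yh, muDF ℳ pQ p0 pM pC W κ (q, x0, x, y, yd, yh) =
      (pQ q * p0 q x0 * pM q x0 (fun i => x i) * (∏ i ∈ ℳᶜ, pC i q (x i)) * W x0 x (y, yd) *
        ∏ j ∈ Finset.univ.erase i, κ j q (y j) (x j) (yh j)) * κ i q (y i) (x i) (yh i) := by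
    intro yh
    simp only [muDF]
    rw [← Finset.mul_prod_erase Finset.univ (fun j => κ j q (y j) (x j) (yh j))
      (Finset.mem_univ i)]
    ring
  have key := sum_pi_mul_ite i (fun yh => if Z (q, x0, x, y, yd, yh) = Z ω then
      (pQ q * p0 q x0 * pM q x0 (fun i => x i) * (∏ i ∈ ℳᶜ, pC i q (x i)) * W x0 x (y, yd) *
        ∏ j ∈ Finset.univ.erase i, κ j q (y j) (x j) (yh j)) else 0) (by
      intro u v huv
      have : ∏ j ∈ Finset.univ.erase i, κ j q (y j) (x j) (u j) =
          ∏ j ∈ Finset.univ.erase i, κ j q (y j) (x j) (v j) :=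
        Finset.prod_congr rfl fun j hj => by rw [huv j (Finset.ne_of_mem_erase hj)]
      simp only [hdep q x0 x y yd u v huv, this]) (κ i q (y i) (x i)) (hκs _ _ _ _)
      (ω.2.2.2.2.2 i)
  simp only [ite_mul, zero_mul, ← hμ, ← ite_and] at key
  simp only [Prod.mk.injEq]
  rw [key]
  by_cases h : ∃ yh, Z (q, x0, x, y, yd, yh) = Z ω
  · obtain ⟨yh, h⟩ := h
    obtain ⟨h1, h2, h3⟩ := hdet _ _ h
    rw [← h1, ← h2, ← h3]
  · push Not at h
    simp [h]

omit [∀ i, DecidableEq (XA i)] [∀ i, DecidableEq (YhA i)] [Fintype γ] in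
lemma massAt_inputs (hWs : ∀ x0 x, ∑ y, W x0 x y = 1)
    (hκs : ∀ i q y x, ∑ yh, κ i q y x yh = 1) (Z : QA × X0A × (∀ i, XA i) → γ) (c : γ) :
    massAt (muDF (YhA := YhA) ℳ pQ p0 pM pC W κ) (fun ω => Z (ω.1, ω.2.1, ω.2.2.1)) c =
      ∑ q, ∑ x0, ∑ x : ∀ i, XA i, if Z (q, x0, x) = c then
        pQ q * p0 q x0 * pM q x0 (fun i => x i) * (∏ i ∈ ℳᶜ, pC i q (x i)) else 0 := by
  have h1 : ∀ (q : QA) (y : ∀ i, YA i) (x : ∀ i, XA i),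
      ∑ yh : ∀ i, YhA i, ∏ i, κ i q (y i) (x i) (yh i) = 1 := by
    intro q y x
    rw [← Fintype.prod_sum]
    simp [hκs]
  simp only [massAt, Finset.sum_filter, Fintype.sum_prod_type]
  refine Finset.sum_congr rfl fun q _ => Finset.sum_congr rfl fun x0 _ =>
    Finset.sum_congr rfl fun x _ => ?_
  split_ifs
  · simp only [muDF, ← Finset.mul_sum, h1, mul_one]
    rw [← Fintype.sum_prod_type, hWs, mul_one]
  · simp

omit [∀ i, DecidableEq (YhA i)] [Fintype γ] in
lemma massAt_input (hpCs : ∀ i q, ∑ x, pC i q x = 1) (hWs : ∀ x0 x, ∑ y, W x0 x y = 1)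
    (hκs : ∀ i q y x, ∑ yh, κ i q y x yh = 1) {i : Fin n} (hi : i ∉ ℳ)
    (Z : QA × X0A × (∀ i, XA i) → γ)
    (hdep : ∀ q x0 x x', (∀ j, j ≠ i → x j = x' j) → Z (q, x0, x) = Z (q, x0, x'))
    (hdet : ∀ t t', Z t = Z t' → t.1 = t'.1)
    (ω : DFOmega QA X0A XA YA YdA YhA) :
    massAt (muDF ℳ pQ p0 pM pC W κ) (fun ω => (ω.2.2.1 i, Z (ω.1, ω.2.1, ω.2.2.1)))
      (ω.2.2.1 i, Z (ω.1, ω.2.1, ω.2.2.1)) =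
      massAt (muDF ℳ pQ p0 pM pC W κ) (fun ω => Z (ω.1, ω.2.1, ω.2.2.1))
        (Z (ω.1, ω.2.1, ω.2.2.1)) * pC i ω.1 (ω.2.2.1 i) := by
  rw [massAt_inputs hWs hκs Z, massAt_inputs hWs hκs (fun t => (t.2.2 i, Z t))]
  simp only [Finset.sum_mul (s := (Finset.univ : Finset QA)),
    Finset.sum_mul (s := (Finset.univ : Finset X0A))]
  refine Finset.sum_congr rfl fun q _ => Finset.sum_congr rfl fun x0 _ => ?_
  have hμ : ∀ x : ∀ i, XA i,
      pQ q * p0 q x0 * pM q x0 (fun i => x i) * (∏ i ∈ ℳᶜ, pC i q (x i)) =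
      (pQ q * p0 q x0 * pM q x0 (fun i => x i) * ∏ j ∈ ℳᶜ.erase i, pC j q (x j)) *
        pC i q (x i) := by
    intro x
    rw [← Finset.mul_prod_erase ℳᶜ (fun j => pC j q (x j)) (Finset.mem_compl.2 hi)]
    ring
  set c := Z (ω.1, ω.2.1, ω.2.2.1)
  have key := sum_pi_mul_ite i (fun x => if Z (q, x0, x) = c then
      (pQ q * p0 q x0 * pM q x0 (fun i => x i) * ∏ j ∈ ℳᶜ.erase i, pC j q (x j)) else 0) (by
      intro u v huv
      have h1 : ∏ j ∈ ℳᶜ.erase i, pC j q (u j) = ∏ j ∈ ℳᶜ.erase i, pC j q (v j) :=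
        Finset.prod_congr rfl fun j hj => by rw [huv j (Finset.ne_of_mem_erase hj)]
      have h2 : (fun j : ℳ => u j) = fun j : ℳ => v j :=
        funext fun j => huv j fun h => hi (h ▸ j.2)
      simp only [hdep q x0 u v huv, h1, h2]) (pC i q) (hpCs _ _) (ω.2.2.1 i)
  simp only [ite_mul, zero_mul, ← hμ, ← ite_and] at key
  simp only [Prod.mk.injEq]
  rw [key]
  by_cases h : ∃ x, Z (q, x0, x) = c
  · obtain ⟨x, h⟩ := h
    rw [← hdet _ _ h]
  · push Not at h
    simp [h]

omit [∀ i, DecidableEq (XA i)] in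
lemma entropy_compressions (hμ : ∀ ω, 0 ≤ muDF ℳ pQ p0 pM pC W κ ω)
    (hκs : ∀ i q y x, ∑ yh, κ i q y x yh = 1) (S : Finset (Fin n))
    (Z : DFOmega QA X0A XA YA YdA YhA → γ)
    (hdep : ∀ q x0 x y yd yh yh', (∀ j, j ∉ S → yh j = yh' j) →
      Z (q, x0, x, y, yd, yh) = Z (q, x0, x, y, yd, yh'))
    (hdet : ∀ ω ω', Z ω = Z ω' →
      ω.1 = ω'.1 ∧ ∀ i ∈ S, ω.2.2.1 i = ω'.2.2.1 i ∧ ω.2.2.2.1 i = ω'.2.2.2.1 i) :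
    entropy (muDF ℳ pQ p0 pM pC W κ) (fun ω => (rvYhS S ω, Z ω)) =
      entropy (muDF ℳ pQ p0 pM pC W κ) Z + ∑ i ∈ S, ∑ ω, muDF ℳ pQ p0 pM pC W κ ω *
        -Real.log (κ i ω.1 (ω.2.2.2.1 i) (ω.2.2.1 i) (ω.2.2.2.2.2 i)) := by
  induction S using Finset.induction_on with
  | empty =>
    rw [Finset.sum_empty, add_zero]
    exact entropy_congr _ fun ω ω' => by simp [rvYhS, funext_iff]
  | insert i S hi ih =>
    rw [Finset.sum_insert hi, add_comm (∑ ω, _), ← add_assoc, ← ih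
      (fun q x0 x y yd yh yh' h => hdep q x0 x y yd yh yh' fun j hj => h j fun hjS =>
        hj (Finset.mem_insert_of_mem hjS))
      (fun ω ω' h => ⟨(hdet ω ω' h).1, fun j hj =>
        (hdet ω ω' h).2 j (Finset.mem_insert_of_mem hj)⟩),
      ← entropy_prod_of_massAt hμ (fun ω => ω.2.2.2.2.2 i) (fun ω => (rvYhS S ω, Z ω)) _
        (massAt_compression hκs i _ ?_ ?_)]
    · exact entropy_congr _ fun ω ω' => by simp [rvYhS, funext_iff, and_assoc]
    · intro q x0 x y yd yh yh' h
      refine Prod.ext (funext fun j => h j fun hj => hi (hj ▸ j.2))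
        (hdep q x0 x y yd yh yh' fun j hj => h j fun hji => hj ?_)
      simp [hji]
    · intro ω ω' h
      obtain ⟨h1, h2⟩ := hdet ω ω' (Prod.mk.inj h).2
      exact ⟨h1, h2 i (Finset.mem_insert_self i S)⟩

omit [∀ i, DecidableEq (YhA i)] in
lemma entropy_inputs (hμ : ∀ ω, 0 ≤ muDF ℳ pQ p0 pM pC W κ ω)
    (hpCs : ∀ i q, ∑ x, pC i q x = 1) (hWs : ∀ x0 x, ∑ y, W x0 x y = 1)
    (hκs : ∀ i q y x, ∑ yh, κ i q y x yh = 1) {R : Finset (Fin n)} (hR : R ⊆ ℳᶜ)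
    (Z : QA × X0A × (∀ i, XA i) → γ)
    (hdep : ∀ q x0 x x', (∀ j ∈ ℳ, x j = x' j) → Z (q, x0, x) = Z (q, x0, x'))
    (hdet : ∀ t t', Z t = Z t' → t.1 = t'.1) :
    entropy (muDF ℳ pQ p0 pM pC W κ)
        (fun ω : DFOmega QA X0A XA YA YdA YhA => (rvXS R ω, Z (ω.1, ω.2.1, ω.2.2.1))) =
      entropy (muDF ℳ pQ p0 pM pC W κ) (fun ω => Z (ω.1, ω.2.1, ω.2.2.1)) +
        ∑ i ∈ R, ∑ ω, muDF ℳ pQ p0 pM pC W κ ω * -Real.log (pC i ω.1 (ω.2.2.1 i)) := by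
  induction R using Finset.induction_on with
  | empty =>
    rw [Finset.sum_empty, add_zero]
    exact entropy_congr _ fun ω ω' => by simp [rvXS, funext_iff]
  | insert i R hi ih =>
    have hiM : i ∉ ℳ := Finset.mem_compl.1 (hR (Finset.mem_insert_self i R))
    rw [Finset.sum_insert hi, add_comm (∑ ω, _), ← add_assoc,
      ← ih fun j hj => hR (Finset.mem_insert_of_mem hj),
      ← entropy_prod_of_massAt hμ (fun ω => ω.2.2.1 i)
        (fun ω => (rvXS R ω, Z (ω.1, ω.2.1, ω.2.2.1))) _
        (massAt_input hpCs hWs hκs hiM (fun t => ((fun j : R => t.2.2 j), Z t)) ?_ ?_)]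
    · exact entropy_congr _ fun ω ω' => by simp [rvXS, funext_iff, and_assoc]
    · intro q x0 x x' h
      exact Prod.ext (funext fun j => h j fun hj => hi (hj ▸ j.2))
        (hdep q x0 x x' fun j hj => h j fun hji => hiM (hji ▸ hj))
    · intro t t' h
      exact hdet t t' (Prod.mk.inj h).2

end Chain

section Potential

variable {n Mc : ℕ} {QA X0A YdA : Type} {XA YA YhA : Fin n → Type}
  [Fintype QA] [DecidableEq QA] [Fintype X0A] [DecidableEq X0A] [Fintype YdA] [DecidableEq YdA]
  [∀ i, Fintype (XA i)] [∀ i, DecidableEq (XA i)]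
  [∀ i, Fintype (YA i)] [∀ i, DecidableEq (YA i)]
  [∀ i, Fintype (YhA i)] [∀ i, DecidableEq (YhA i)]
  {β γ δ : Type*} [Fintype β] [DecidableEq β] [Fintype γ] [DecidableEq γ]
  [Fintype δ] [DecidableEq δ]

/-- `H(Xᵢ|Q) + H(Ŷᵢ|Yᵢ,Xᵢ,Q)`, expressed through the kernels generating `Xᵢ` and `Ŷᵢ`. -/
noncomputable def relayCost (μ : DFOmega QA X0A XA YA YdA YhA → ℝ)
    (pC : ∀ i : Fin n, QA → XA i → ℝ) (κ : ∀ i : Fin n, QA → YA i → XA i → YhA i → ℝ)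
    (i : Fin n) : ℝ :=
  ∑ ω, μ ω * -Real.log (pC i ω.1 (ω.2.2.1 i)) +
    ∑ ω, μ ω * -Real.log (κ i ω.1 (ω.2.2.2.1 i) (ω.2.2.1 i) (ω.2.2.2.2.2 i))

/-- `H(Ŷ_R, X_R, Y_{π(k)} | B)` minus the costs of the relays in `R`. -/
noncomputable def relayPotential (σ : Fin Mc → Fin n) (k : Fin (Mc + 1))
    (μ : DFOmega QA X0A XA YA YdA YhA → ℝ) (cost : Fin n → ℝ)
    (B : DFOmega QA X0A XA YA YdA YhA → β) (R : Finset (Fin n)) : ℝ :=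
  entropy μ (fun ω => (rvYhS R ω, rvXS R ω, rvYk σ k ω, B ω)) - entropy μ B - ∑ i ∈ R, cost i

/-- All inputs of decode-and-forward nodes together with the time-sharing variable. -/
def dfInputs (ℳ : Finset (Fin n)) (t : QA × X0A × (∀ i, XA i)) :
    (X0A × (∀ i : ℳ, XA i)) × QA :=
  ((t.2.1, fun j => t.2.2 j), t.1)

/-- The inputs of downstream decode-and-forward nodes together with the time-sharing variable. -/
def downInputs (σ : Fin Mc → Fin n) (k : Fin (Mc + 1)) (t : QA × X0A × (∀ i, XA i)) :
    (∀ i : downSet σ k, XA i) × QA :=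
  (fun j => t.2.2 j, t.1)

omit [Fintype QA] [DecidableEq QA] [Fintype X0A] [DecidableEq X0A] [Fintype YdA] [DecidableEq YdA]
  [∀ i, Fintype (XA i)] [∀ i, DecidableEq (XA i)] [∀ i, Fintype (YA i)] [∀ i, DecidableEq (YA i)]
  [∀ i, Fintype (YhA i)] [∀ i, DecidableEq (YhA i)] in
lemma rvYk_congr (σ : Fin Mc → Fin n) (k : Fin (Mc + 1)) (q : QA) (x0 : X0A) (x : ∀ i, XA i)
    (y : ∀ i, YA i) (yd : YdA) (yh yh' : ∀ i, YhA i) :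
    rvYk σ k (q, x0, x, y, yd, yh) = rvYk σ k (q, x0, x, y, yd, yh') := rfl

lemma condMI_sub_condMI_eq_potential_sub {ℳ : Finset (Fin n)} {pQ : QA → ℝ} {p0 : QA → X0A → ℝ}
    {pM : QA → X0A → (∀ i : ℳ, XA i) → ℝ} {pC : ∀ i : Fin n, QA → XA i → ℝ}
    {W : X0A → (∀ i, XA i) → ((∀ i, YA i) × YdA) → ℝ}
    {κ : ∀ i : Fin n, QA → YA i → XA i → YhA i → ℝ}
    (hμ : ∀ ω, 0 ≤ muDF ℳ pQ p0 pM pC W κ ω)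
    (hpCs : ∀ i q, ∑ x, pC i q x = 1) (hWs : ∀ x0 x, ∑ y, W x0 x y = 1)
    (hκs : ∀ i q y x, ∑ yh, κ i q y x yh = 1) (σ : Fin Mc → Fin n) (k : Fin (Mc + 1))
    {S T : Finset (Fin n)} (hST : S ⊆ T) (hT : T ⊆ ℳᶜ)
    (B : QA × X0A × (∀ i, XA i) → β)
    (hdep : ∀ q x0 x x', (∀ j ∈ ℳ, x j = x' j) → B (q, x0, x) = B (q, x0, x'))
    (hdet : ∀ t t', B t = B t' → t.1 = t'.1)
    (X : DFOmega QA X0A XA YA YdA YhA → γ) (C : DFOmega QA X0A XA YA YdA YhA → δ)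
    (hC : ∀ ω ω', C ω = C ω' ↔ rvXS (T \ S) ω = rvXS (T \ S) ω' ∧
      B (ω.1, ω.2.1, ω.2.2.1) = B (ω'.1, ω'.2.1, ω'.2.2.1))
    (hX : ∀ ω ω', (X ω = X ω' ∧ C ω = C ω') ↔ rvXS T ω = rvXS T ω' ∧
      dfInputs ℳ (ω.1, ω.2.1, ω.2.2.1) = dfInputs ℳ (ω'.1, ω'.2.1, ω'.2.2.1)) :
    condMI (muDF ℳ pQ p0 pM pC W κ) X (fun ω => (rvYhS (T \ S) ω, rvYk σ k ω)) C -
      condMI (muDF ℳ pQ p0 pM pC W κ) (rvYS S) (rvYhS S)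
        (fun ω => ((rvX0 ω, rvXS ℳ ω), rvXS T ω, rvYk σ k ω, rvYhS (T \ S) ω, rvQ ω)) =
    relayPotential σ k (muDF ℳ pQ p0 pM pC W κ) (relayCost (muDF ℳ pQ p0 pM pC W κ) pC κ)
        (fun ω => B (ω.1, ω.2.1, ω.2.2.1)) (T \ S) -
      relayPotential σ k (muDF ℳ pQ p0 pM pC W κ) (relayCost (muDF ℳ pQ p0 pM pC W κ) pC κ)
        (fun ω => dfInputs ℳ (ω.1, ω.2.1, ω.2.2.1)) T := by
  have hR : T \ S ⊆ ℳᶜ := Finset.sdiff_subset.trans hT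
  have hmem : ∀ i, i ∈ T ↔ i ∈ S ∨ i ∈ T \ S := fun i => by
    have := @hST i
    simp only [Finset.mem_sdiff]
    tauto
  have hYh : ∀ ω ω' : DFOmega QA X0A XA YA YdA YhA, rvYhS T ω = rvYhS T ω' ↔
      rvYhS S ω = rvYhS S ω' ∧ rvYhS (T \ S) ω = rvYhS (T \ S) ω' := fun ω ω' => by
    simp only [rvYhS, funext_iff, Subtype.forall, hmem]
    grind
  have hL : ∀ ω ω' : DFOmega QA X0A XA YA YdA YhA,
      dfInputs ℳ (ω.1, ω.2.1, ω.2.2.1) = dfInputs ℳ (ω'.1, ω'.2.1, ω'.2.2.1) ↔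
      (rvX0 ω = rvX0 ω' ∧ rvXS ℳ ω = rvXS ℳ ω') ∧ rvQ ω = rvQ ω' := fun ω ω' => by
    simp only [dfInputs, Prod.mk.injEq]
    rfl
  set μ := muDF ℳ pQ p0 pM pC W κ with hμdef
  have e1 : entropy μ (fun ω => (X ω, C ω)) =
      entropy μ (fun ω => (rvXS T ω, dfInputs ℳ (ω.1, ω.2.1, ω.2.2.1))) :=
    entropy_congr _ fun ω ω' => by simp only [Prod.mk.injEq, hX]
  rw [hμdef, entropy_inputs hμ hpCs hWs hκs hT (dfInputs ℳ)
    (fun q x0 x x' h => Prod.ext (Prod.ext rfl (funext fun j => h j j.2)) rfl)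
    (fun t t' h => (Prod.mk.inj h).2), ← hμdef] at e1
  have e2 : entropy μ (fun ω => ((rvYhS (T \ S) ω, rvYk σ k ω), C ω)) =
      entropy μ (fun ω => (rvYhS (T \ S) ω, rvXS (T \ S) ω, rvYk σ k ω,
        B (ω.1, ω.2.1, ω.2.2.1))) :=
    entropy_congr _ fun ω ω' => by simp only [Prod.mk.injEq, hC]; tauto
  have e3 : entropy μ (fun ω => (X ω, (rvYhS (T \ S) ω, rvYk σ k ω), C ω)) =
      entropy μ (fun ω =>
        ((rvX0 ω, rvXS ℳ ω), rvXS T ω, rvYk σ k ω, rvYhS (T \ S) ω, rvQ ω)) :=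
    entropy_congr _ fun ω ω' => by
      have h1 := hX ω ω'
      have h2 := hL ω ω'
      simp only [Prod.mk.injEq]
      tauto
  have e4 : entropy μ C = entropy μ (fun ω => (rvXS (T \ S) ω, B (ω.1, ω.2.1, ω.2.2.1))) :=
    entropy_congr _ fun ω ω' => by simp only [Prod.mk.injEq, hC]
  rw [hμdef, entropy_inputs hμ hpCs hWs hκs hR B hdep hdet, ← hμdef] at e4
  have e6 : entropy μ (fun ω => (rvYhS S ω,
        ((rvX0 ω, rvXS ℳ ω), rvXS T ω, rvYk σ k ω, rvYhS (T \ S) ω, rvQ ω))) =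
      entropy μ (fun ω => (rvYhS T ω, rvXS T ω, rvYk σ k ω,
        dfInputs ℳ (ω.1, ω.2.1, ω.2.2.1))) :=
    entropy_congr _ fun ω ω' => by
      simp only [Prod.mk.injEq, hL, hYh]
      tauto
  have e7 : entropy μ (fun ω => (rvYS S ω, rvYhS S ω,
        ((rvX0 ω, rvXS ℳ ω), rvXS T ω, rvYk σ k ω, rvYhS (T \ S) ω, rvQ ω))) =
      entropy μ (fun ω => (rvYhS S ω, (rvYS S ω,
        ((rvX0 ω, rvXS ℳ ω), rvXS T ω, rvYk σ k ω, rvYhS (T \ S) ω, rvQ ω)))) :=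
    entropy_congr _ fun ω ω' => by
      simp only [Prod.mk.injEq]
      tauto
  rw [hμdef, entropy_compressions hμ hκs S, ← hμdef] at e7
  rotate_left
  · intro q x0 x y yd yh yh' h
    have : (rvYhS (T \ S) (q, x0, x, y, yd, yh) : ∀ i : ↥(T \ S), YhA i) =
        rvYhS (T \ S) (q, x0, x, y, yd, yh') :=
      funext fun j => h j (Finset.mem_sdiff.1 j.2).2
    rw [this, rvYk_congr σ k q x0 x y yd yh yh']
    rfl
  · intro ω ω' h
    simp only [Prod.mk.injEq] at h
    obtain ⟨hY, -, hXT, -, -, hQ⟩ := h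
    exact ⟨hQ, fun i hi => ⟨congrFun hXT ⟨i, hST hi⟩, congrFun hY ⟨i, hi⟩⟩⟩
  have s1 := Finset.sum_sdiff (f := relayCost μ pC κ) hST
  have s2 := Finset.sum_sdiff
    (f := fun i => ∑ ω, μ ω * -Real.log (pC i ω.1 (ω.2.2.1 i))) hST
  have s3 : ∑ i ∈ S, relayCost μ pC κ i =
      ∑ i ∈ S, ∑ ω, μ ω * -Real.log (pC i ω.1 (ω.2.2.1 i)) + ∑ i ∈ S, ∑ ω, μ ω *
        -Real.log (κ i ω.1 (ω.2.2.2.1 i) (ω.2.2.1 i) (ω.2.2.2.2.2 i)) := by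
    simp only [relayCost, Finset.sum_add_distrib]
  simp only [condMI, relayPotential, e1, e2, e3, e4, e6, e7]
  linarith

omit [DecidableEq QA] [DecidableEq X0A] in
lemma relayPotential_submodular {μ : DFOmega QA X0A XA YA YdA YhA → ℝ} (hμ : ∀ ω, 0 ≤ μ ω)
    (σ : Fin Mc → Fin n) (k : Fin (Mc + 1)) (cost : Fin n → ℝ)
    (B : DFOmega QA X0A XA YA YdA YhA → β) (R T : Finset (Fin n)) :
    relayPotential σ k μ cost B (R ∪ T) + relayPotential σ k μ cost B (R ∩ T) ≤
      relayPotential σ k μ cost B R + relayPotential σ k μ cost B T := by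
  have h := condMI_nonneg hμ (fun ω => (rvYhS R ω, rvXS R ω)) (fun ω => (rvYhS T ω, rvXS T ω))
    (fun ω => (rvYhS (R ∩ T) ω, rvXS (R ∩ T) ω, rvYk σ k ω, B ω))
  rw [condMI,
    entropy_congr μ (Y := fun ω => (rvYhS R ω, rvXS R ω, rvYk σ k ω, B ω)) fun ω ω' => ?_,
    entropy_congr μ (X := fun ω => ((rvYhS T ω, rvXS T ω), _))
      (Y := fun ω => (rvYhS T ω, rvXS T ω, rvYk σ k ω, B ω)) fun ω ω' => ?_,
    entropy_congr μ (X := fun ω => (_, (rvYhS T ω, rvXS T ω), _))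
      (Y := fun ω => (rvYhS (R ∪ T) ω, rvXS (R ∪ T) ω, rvYk σ k ω, B ω)) fun ω ω' => ?_] at h
  · have := Finset.sum_union_inter (s₁ := R) (s₂ := T) (f := cost)
    simp only [relayPotential]
    linarith
  all_goals
    simp only [Prod.mk.injEq, rvYhS, rvXS, funext_iff, Subtype.forall, Finset.mem_inter,
      Finset.mem_union]
    grind

omit [DecidableEq QA] [DecidableEq X0A] in
/-- Coarsening the conditioning variable makes the potential grow faster. -/
lemma relayPotential_sub_mono {μ : DFOmega QA X0A XA YA YdA YhA → ℝ} (hμ : ∀ ω, 0 ≤ μ ω)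
    (σ : Fin Mc → Fin n) (k : Fin (Mc + 1)) (cost : Fin n → ℝ)
    (B : DFOmega QA X0A XA YA YdA YhA → β) (V : DFOmega QA X0A XA YA YdA YhA → γ)
    (hVB : ∀ ω ω', V ω = V ω' → B ω = B ω') {R T : Finset (Fin n)} (hRT : R ⊆ T) :
    relayPotential σ k μ cost B R - relayPotential σ k μ cost V R ≤
      relayPotential σ k μ cost B T - relayPotential σ k μ cost V T := by
  have h := condMI_nonneg hμ (fun ω => (rvYhS T ω, rvXS T ω)) V
    (fun ω => (rvYhS R ω, rvXS R ω, rvYk σ k ω, B ω))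
  rw [condMI,
    entropy_congr μ (Y := fun ω => (rvYhS T ω, rvXS T ω, rvYk σ k ω, B ω)) fun ω ω' => ?_,
    entropy_congr μ (X := fun ω => (V ω, _))
      (Y := fun ω => (rvYhS R ω, rvXS R ω, rvYk σ k ω, V ω)) fun ω ω' => ?_,
    entropy_congr μ (X := fun ω => (_, V ω, _))
      (Y := fun ω => (rvYhS T ω, rvXS T ω, rvYk σ k ω, V ω)) fun ω ω' => ?_] at h
  · simp only [relayPotential]
    linarith
  all_goals
    have := hVB ω ω'
    simp only [Prod.mk.injEq, rvYhS, rvXS, funext_iff, Subtype.forall]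
    grind

end Potential

lemma inf'_sdiff_le_of_submodular {ι : Type*} [DecidableEq ι] {U D T : Finset ι}
    {φ h : Finset ι → ℝ} (hφ : ∀ R T, φ (R ∪ T) + φ (R ∩ T) ≤ φ R + φ T)
    (hmono : ∀ R T, R ⊆ T → φ R - h R ≤ φ T - h T)
    (hD : D ⊆ U) (hmin : ∀ T ⊆ U, h D ≤ h T) (hT : T ⊆ U) :
    T.powerset.inf' (Finset.powerset_nonempty T) (fun S => φ (T \ S) - h T) ≤
      D.powerset.inf' (Finset.powerset_nonempty D) (fun S => φ (D \ S) - h D) := by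
  refine Finset.le_inf' _ _ fun S _ => ?_
  refine (Finset.inf'_le _ (b := T \ (D \ S)) (by simp)).trans ?_
  have h1 := hφ (D \ S) T
  have h2 := hmono T (D \ S ∪ T) Finset.subset_union_right
  have h3 := hmin (D \ S ∪ T) (Finset.union_subset (Finset.sdiff_subset.trans hD) hT)
  have h4 : T \ (T \ (D \ S)) = D \ S ∩ T := by
    rw [sdiff_sdiff_right_self]; exact inf_comm _ _
  simp only [h4]
  linarith

/-- For every `k ∈ {2,…,M+2}` (encoded as `k : Fin (Mc+1)`, paper
index `k+2`), the maximum over all subsets `T ⊆ N∖M` of `F_k(T)` is attained at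
`T = D_k`, where `D_k` is the unique largest subset of `N∖M` that is self-decodable
at node `π(k)`: `F_k(D_k) = max_{T ⊆ N∖M} F_k(T)`. -/
theorem Fk_max_at_largest_selfDecodable
    {n Mc : ℕ} {QA X0A YdA : Type} {XA YA YhA : Fin n → Type}
    [Fintype QA] [DecidableEq QA] [Fintype X0A] [DecidableEq X0A]
    [Fintype YdA] [DecidableEq YdA]
    [∀ i, Fintype (XA i)] [∀ i, DecidableEq (XA i)]
    [∀ i, Fintype (YA i)] [∀ i, DecidableEq (YA i)]
    [∀ i, Fintype (YhA i)] [∀ i, DecidableEq (YhA i)]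
    (ℳ : Finset (Fin n)) (hMcard : ℳ.card = Mc)
    (σ : Fin Mc → Fin n) (hσinj : Function.Injective σ)
    (hσmem : ∀ j, σ j ∈ ℳ) (hσsurj : ∀ i ∈ ℳ, ∃ j, σ j = i)
    (pQ : QA → ℝ) (p0 : QA → X0A → ℝ)
    (pM : QA → X0A → (∀ i : ℳ, XA i) → ℝ) (pC : ∀ i : Fin n, QA → XA i → ℝ)
    (W : X0A → (∀ i, XA i) → ((∀ i, YA i) × YdA) → ℝ)
    (κ : ∀ i : Fin n, QA → YA i → XA i → YhA i → ℝ)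
    (hpQ : ∀ q, 0 ≤ pQ q) (hpQs : ∑ q, pQ q = 1)
    (hp0 : ∀ q x, 0 ≤ p0 q x) (hp0s : ∀ q, ∑ x, p0 q x = 1)
    (hpM : ∀ q x0 xm, 0 ≤ pM q x0 xm) (hpMs : ∀ q x0, ∑ xm, pM q x0 xm = 1)
    (hpC : ∀ i q x, 0 ≤ pC i q x) (hpCs : ∀ i q, ∑ x, pC i q x = 1)
    (hW : ∀ x0 x y, 0 ≤ W x0 x y) (hWs : ∀ x0 x, ∑ y, W x0 x y = 1)
    (hκ : ∀ i q y x yh, 0 ≤ κ i q y x yh) (hκs : ∀ i q y x, ∑ yh, κ i q y x yh = 1)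
    (k : Fin (Mc + 1)) (Dk : Finset (Fin n)) (hDsub : Dk ⊆ ℳᶜ)
    (hDdec : SelfDecodable ℳ σ (muDF ℳ pQ p0 pM pC W κ) k Dk)
    (hDmax : ∀ E ⊆ ℳᶜ, SelfDecodable ℳ σ (muDF ℳ pQ p0 pM pC W κ) k E → E ⊆ Dk) :
    Fk ℳ σ (muDF ℳ pQ p0 pM pC W κ) k Dk =
      ℳᶜ.powerset.sup' (Finset.powerset_nonempty _)
        (Fk ℳ σ (muDF ℳ pQ p0 pM pC W κ) k) := by
  set μ := muDF ℳ pQ p0 pM pC W κ with hμdef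
  have hμ : ∀ ω, 0 ≤ μ ω := fun ω => by
    have h1 := Finset.prod_nonneg fun i (_ : i ∈ ℳᶜ) => hpC i ω.1 (ω.2.2.1 i)
    have h2 := Finset.prod_nonneg fun i (_ : i ∈ Finset.univ) =>
      hκ i ω.1 (ω.2.2.2.1 i) (ω.2.2.1 i) (ω.2.2.2.2.2 i)
    exact mul_nonneg (mul_nonneg (mul_nonneg (mul_nonneg (mul_nonneg (hpQ _) (hp0 _ _))
      (hpM _ _ _)) h1) (hW _ _ _)) h2
  have hmem : ∀ i, i ∈ ℳ ↔ i ∈ upSet σ k ∨ i ∈ downSet σ k := by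
    intro i
    simp only [upSet, downSet, Finset.mem_image, Finset.mem_filter, Finset.mem_univ, true_and]
    constructor
    · intro hi
      obtain ⟨j, rfl⟩ := hσsurj i hi
      exact (lt_or_ge (j : ℕ) k).imp (fun h => ⟨j, h, rfl⟩) fun h => ⟨j, h, rfl⟩
    · rintro (⟨j, -, rfl⟩ | ⟨j, -, rfl⟩) <;> exact hσmem j
  set φ := relayPotential σ k μ (relayCost μ pC κ)
    (fun ω => downInputs σ k (ω.1, ω.2.1, ω.2.2.1)) with hφdef
  set h := relayPotential σ k μ (relayCost μ pC κ)
    (fun ω => dfInputs ℳ (ω.1, ω.2.1, ω.2.2.1)) with hhdef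
  have hF : ∀ T ⊆ ℳᶜ, Fk ℳ σ μ k T =
      T.powerset.inf' (Finset.powerset_nonempty T) (fun S => φ (T \ S) - h T) := by
    intro T hT
    refine Finset.inf'_congr _ rfl fun S hS => ?_
    have hST := Finset.mem_powerset.1 hS
    refine condMI_sub_condMI_eq_potential_sub hμ hpCs hWs hκs σ k hST hT (downInputs σ k)
      (fun q x0 x x' hx => Prod.ext (funext fun j => hx j ((hmem j).2 (Or.inr j.2))) rfl)
      (fun t t' ht => (Prod.mk.inj ht).2) _ _ (fun ω ω' => ?_) (fun ω ω' => ?_)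
    · simp only [Prod.mk.injEq, downInputs]
      rfl
    · simp only [Prod.mk.injEq, dfInputs, rvXS, rvX0, rvQ, funext_iff, Subtype.forall, hmem,
        Finset.mem_sdiff]
      grind
  have hSD : ∀ D ⊆ ℳᶜ, (SelfDecodable ℳ σ μ k D ↔
      ∀ S ⊆ D, S.Nonempty → h D < h (D \ S)) := by
    intro D hD
    refine forall₃_congr fun S hS _ => ?_
    rw [condMI_sub_condMI_eq_potential_sub hμ hpCs hWs hκs σ k hS hD (dfInputs ℳ)
      (fun q x0 x x' hx => Prod.ext (Prod.ext rfl (funext fun j => hx j j.2)) rfl)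
      (fun t t' ht => (Prod.mk.inj ht).2) _ _ (fun ω ω' => ?_) (fun ω ω' => ?_), sub_pos]
    · simp only [Prod.mk.injEq, dfInputs, rvX0, rvQ]
      tauto
    · simp only [Prod.mk.injEq, dfInputs, rvXS, rvX0, rvQ, funext_iff, Subtype.forall,
        Finset.mem_sdiff]
      grind
  have hmin : ∀ T ⊆ ℳᶜ, h Dk ≤ h T := by
    obtain ⟨D, hD, hDle⟩ := Finset.exists_min_image ℳᶜ.powerset
      (fun T => toLex (h T, T.card)) (Finset.powerset_nonempty _)
    rw [Finset.mem_powerset] at hD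
    have hle : ∀ T ⊆ ℳᶜ, h D < h T ∨ h D = h T ∧ D.card ≤ T.card := fun T hT => by
      simpa [Prod.Lex.toLex_le_toLex] using hDle T (Finset.mem_powerset.2 hT)
    have hDk : D ⊆ Dk := hDmax D hD <| (hSD D hD).2 fun S hS hne =>
      (hle (D \ S) (Finset.sdiff_subset.trans hD)).resolve_right fun hcard =>
        (Finset.card_lt_card (Finset.sdiff_ssubset hS hne)).not_ge hcard.2
    have hDkD : h Dk ≤ h D := by
      rcases hDk.eq_or_ssubset with rfl | hss
      · exact le_rfl
      · have := (hSD Dk hDsub).1 hDdec (Dk \ D) Finset.sdiff_subset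
          (Finset.sdiff_nonempty.2 hss.2)
        rw [Finset.sdiff_sdiff_eq_self hDk] at this
        exact this.le
    intro T hT
    rcases hle T hT with hlt | ⟨heq, -⟩
    · exact hDkD.trans hlt.le
    · exact hDkD.trans heq.le
  refine le_antisymm (Finset.le_sup' _ (Finset.mem_powerset.2 hDsub))
    (Finset.sup'_le _ _ fun T hT => ?_)
  rw [Finset.mem_powerset] at hT
  rw [hF T hT, hF Dk hDsub]
  refine inf'_sdiff_le_of_submodular (relayPotential_submodular hμ σ k _ _)
    (fun R T hRT => relayPotential_sub_mono hμ σ k _ _ _ (fun ω ω' hV => ?_) hRT) hDsub hmin hT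
  simp only [Prod.mk.injEq, dfInputs, downInputs, funext_iff, Subtype.forall, hmem] at hV ⊢
  exact ⟨fun i hi => hV.1.2 i (Or.inr hi), hV.2⟩
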